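/- Let n ≥ 3 and let c = (c_1,…,c_m) be a cardinality sequence with m ≥ 2 and 2 ≤ c_1 < ⋯ < c_m ≤ n. Then the dimension of the cardinality constrained path polytope P_{0,n-path}^c(D̃_n) equals n² − 2n. -/

import Mathlib

open Finset

/-- The arc set `Ã_n` of the digraph `D̃_n` on the node set `Ñ_n = {0,1,…,n} = Fin (n+1)`:
all arcs `(i,j)` with `i ≠ j`, except those entering `0`, those leaving `n`, and the arc
`(0,n)`.  This is exactly
`{(0,i),(i,n) : 1 ≤ i ≤ n-1} ∪ {(i,j) : 1 ≤ i,j ≤ n-1, i ≠ j}`. -/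
def tA (n : ℕ) : Finset (Fin (n + 1) × Fin (n + 1)) :=
  Finset.univ.filter (fun a => a.1 ≠ a.2 ∧ a.2 ≠ 0 ∧ a.1 ≠ Fin.last n ∧
    ¬(a.1 = 0 ∧ a.2 = Fin.last n))

/-- A simple directed `(0,n)`-path in `D̃_n`, encoded by its arc set: there is an
injective map `f` from `Fin (k+1)` to the nodes with `f 0 = 0` and `f k = n` whose
consecutive pairs are exactly the arcs of `P` (so `P` has `k` arcs). -/
def IsTildePath (n : ℕ) (P : Finset (Fin (n + 1) × Fin (n + 1))) : Prop :=
  P ⊆ tA n ∧ ∃ (k : ℕ) (f : Fin (k + 1) → Fin (n + 1)), Function.Injective f ∧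
    f 0 = 0 ∧ f (Fin.last k) = Fin.last n ∧
    P = Finset.image (fun i : Fin k => (f (Fin.castSucc i), f (Fin.succ i))) Finset.univ

/-- Incidence vector of an arc set. -/
noncomputable def incVec {N : ℕ} (C : Finset (Fin N × Fin N)) : Fin N → Fin N → ℝ :=
  fun i j => if (i, j) ∈ C then 1 else 0

/-- The cardinality constrained path polytope `P_{0,n-path}^c(D̃_n)`: the convex hull of
the incidence vectors of simple `(0,n)`-paths whose cardinality is `c p` for some `p`. -/
noncomputable def pathPolytope (n : ℕ) {m : ℕ} (c : Fin m → ℕ) :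
    Set (Fin (n + 1) → Fin (n + 1) → ℝ) :=
  convexHull ℝ {x | ∃ P, IsTildePath n P ∧ (∃ p, P.card = c p) ∧ x = incVec P}

/-- `x(δ^out(i))` in `D̃_n`. -/
noncomputable def outT (n : ℕ) (x : Fin (n + 1) → Fin (n + 1) → ℝ) (i : Fin (n + 1)) :
    ℝ :=
  ∑ a ∈ (tA n).filter (fun a => a.1 = i), x a.1 a.2

/-- `x(δ^in(i))` in `D̃_n`. -/
noncomputable def inT (n : ℕ) (x : Fin (n + 1) → Fin (n + 1) → ℝ) (i : Fin (n + 1)) :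
    ℝ :=
  ∑ a ∈ (tA n).filter (fun a => a.2 = i), x a.1 a.2

/-- The dimension (of the affine hull) of a subset of a real vector space. -/
noncomputable def adim {V : Type*} [AddCommGroup V] [Module ℝ V] (P : Set V) : ℕ :=
  Module.finrank ℝ (vectorSpan ℝ P)

/-- The valid inequality `f x ≤ b` defines a facet of `P`: it is valid and its face has
dimension `(dim P) - 1`. -/
def IsFacetLE {V : Type*} [AddCommGroup V] [Module ℝ V] (P : Set V) (f : V → ℝ) (b : ℝ) :
    Prop :=
  (∀ x ∈ P, f x ≤ b) ∧ adim {x ∈ P | f x = b} + 1 = adim P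

/-- The valid inequality `f x ≥ b` defines a facet of `P`: it is valid and its face has
dimension `(dim P) - 1`. -/
def IsFacetGE {V : Type*} [AddCommGroup V] [Module ℝ V] (P : Set V) (f : V → ℝ) (b : ℝ) :
    Prop :=
  (∀ x ∈ P, b ≤ f x) ∧ adim {x ∈ P | f x = b} + 1 = adim P

open Function

/-- If all simple sequences of `k + 1` vertices have the same total cost, made of arc costs `h` and
a terminal cost `t`, then closing such a sequence to a cycle determines its arc costs. -/
lemma mul_arc_sub_terminal_eq {V : Type*} (h : V → V → ℝ) (t : V → ℝ) (γ : ℝ) {k : ℕ}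
    (hcost : ∀ w : Fin (k + 1) → V, Injective w →
      ∑ i : Fin k, h (w i.castSucc) (w i.succ) + t (w (Fin.last k)) = γ)
    (w : Fin (k + 1) → V) (hw : Injective w) :
    k * (h (w 0) (w 1) - t (w 0)) = γ - ∑ i, t (w i) := by
  set H : ℝ := ∑ i, h (w i) (w (i + 1)) with hH
  have key (s : Fin (k + 1)) : H - h (w s) (w (s + 1)) + t (w s) = γ := by
    have h1 := hcost (fun i => w (i + (s - Fin.last k))) fun i j hij => by
      simpa using hw hij
    have h2 : H = ∑ i, h (w (i + (s - Fin.last k))) (w (i + (s - Fin.last k) + 1)) :=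
      (Equiv.sum_comp (Equiv.addRight (s - Fin.last k)) fun i => h (w i) (w (i + 1))).symm
    rw [Fin.sum_univ_castSucc] at h2
    have h3 (i : Fin k) : i.castSucc + (s - Fin.last k) + 1 = i.succ + (s - Fin.last k) := by
      rw [← Fin.coeSucc_eq_succ]; abel
    simp only [h3, add_sub_cancel] at h1 h2
    linarith
  have hsum : ∑ s, (H - h (w s) (w (s + 1)) + t (w s)) = ∑ _s : Fin (k + 1), γ :=
    Finset.sum_congr rfl fun s _ => key s
  rw [Finset.sum_add_distrib, Finset.sum_sub_distrib, ← hH] at hsum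
  simp only [Finset.sum_const, Finset.card_univ, Fintype.card_fin, nsmul_eq_mul] at hsum
  push_cast at hsum
  have h0 := key 0
  rw [zero_add] at h0
  have h1 : h (w 0) (w 1) - t (w 0) = H - γ := by linarith
  rw [h1]
  linarith

lemma exists_injective_map_pair {k N : ℕ} (hk : k ≤ N) {p q : Fin k} (hpq : p ≠ q)
    {i j : Fin N} (hij : i ≠ j) :
    ∃ v : Fin k → Fin N, Injective v ∧ v p = i ∧ v q = j := by
  let e := Fin.castLE hk
  have he : Injective e := Fin.castLE_injective hk
  let σ := Equiv.swap (e p) i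
  have h1 : σ (e q) ≠ i := fun h => by
    have : σ (e q) = σ (e p) := by rw [h, Equiv.swap_apply_left]
    exact hpq (he (σ.injective this)).symm
  refine ⟨fun x => Equiv.swap (σ (e q)) j (σ (e x)),
    (Equiv.injective _).comp (σ.injective.comp he), ?_, Equiv.swap_apply_left _ _⟩
  simp only [σ, Equiv.swap_apply_left]
  exact Equiv.swap_apply_of_ne_of_ne h1.symm hij

/-- If all simple sequences of `a + 1` vertices and all those of `b + 1` vertices have the same
total cost, made of arc costs `h` and a terminal cost `t`, then the arc costs vanish and the
terminal cost is constant. -/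
lemma arc_cost_eq_zero {N a b : ℕ} (hab : a < b) (hbN : b + 1 ≤ N)
    (h : Fin N → Fin N → ℝ) (t : Fin N → ℝ) (γ : ℝ)
    (ha : ∀ w : Fin (a + 1) → Fin N, Injective w →
      ∑ i : Fin a, h (w i.castSucc) (w i.succ) + t (w (Fin.last a)) = γ)
    (hb : ∀ w : Fin (b + 1) → Fin N, Injective w →
      ∑ i : Fin b, h (w i.castSucc) (w i.succ) + t (w (Fin.last b)) = γ) :
    (∀ i j, i ≠ j → h i j = 0) ∧ ∀ i, t i = γ := by
  have hb0 : (b : ℝ) ≠ 0 := by exact_mod_cast (by omega : b ≠ 0)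
  let ε : Fin (a + 1) → Fin (b + 1) := Fin.castLE (by omega)
  have hε : Injective ε := Fin.castLE_injective _
  have hε0 : ε 0 = 0 := rfl
  have hε1 (hapos : 0 < a) : ε 1 = 1 := by
    obtain ⟨a, rfl⟩ := Nat.exists_eq_succ_of_ne_zero hapos.ne'
    obtain ⟨b, rfl⟩ := Nat.exists_eq_succ_of_ne_zero (by omega : b ≠ 0)
    rfl
  have tconst (i j : Fin N) : t i = t j := by
    rcases eq_or_ne i j with rfl | hij
    · rfl
    obtain ⟨v, hv, hvi, hvj⟩ := exists_injective_map_pair hbN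
      (p := 0) (q := ⟨a + 1, by omega⟩) (by simp [Fin.ext_iff]) hij
    let q : Fin (b + 1) := ⟨a + 1, by omega⟩
    let v' := v ∘ Equiv.swap 0 q
    have hv' : Injective v' := hv.comp (Equiv.injective _)
    have hsum : ∑ x, t (v' x) = ∑ x, t (v x) :=
      Equiv.sum_comp (Equiv.swap 0 q) fun x => t (v x)
    have e1 := mul_arc_sub_terminal_eq h t γ hb v hv
    have e2 := mul_arc_sub_terminal_eq h t γ hb v' hv'
    have e3 := mul_arc_sub_terminal_eq h t γ ha (v ∘ ε) (hv.comp hε)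
    have e4 := mul_arc_sub_terminal_eq h t γ ha (v' ∘ ε) (hv'.comp hε)
    have hx : h (v 0) (v 1) - t (v 0) = h (v' 0) (v' 1) - t (v' 0) :=
      mul_left_cancel₀ hb0 (by rw [e1, e2, hsum])
    have hy : (a : ℝ) * (h ((v ∘ ε) 0) ((v ∘ ε) 1) - t ((v ∘ ε) 0)) =
        a * (h ((v' ∘ ε) 0) ((v' ∘ ε) 1) - t ((v' ∘ ε) 0)) := by
      rcases Nat.eq_zero_or_pos a with rfl | hapos
      · simp
      · simp only [comp_apply (g := ε), hε0, hε1 hapos, hx]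
    rw [e3, e4, Fin.sum_univ_succ, Fin.sum_univ_succ] at hy
    have hrest (x : Fin a) : (v' ∘ ε) x.succ = (v ∘ ε) x.succ := by
      refine congrArg v (Equiv.swap_apply_of_ne_of_ne ?_ ?_)
      · exact fun hx0 => Fin.succ_ne_zero x (hε (hx0.trans hε0.symm))
      · intro hxq
        have := congrArg Fin.val hxq
        have := x.isLt
        simp [ε, q] at *
        omega
    simp only [hrest] at hy
    have h0 : (v' ∘ ε) 0 = j := by
      simp only [comp_apply, hε0, v', Equiv.swap_apply_left]; exact hvj
    have h1 : (v ∘ ε) 0 = i := hvi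
    rw [h0, h1] at hy
    linarith
  have arc (i j : Fin N) (hij : i ≠ j) : h i j = 0 ∧ t i = γ := by
    obtain ⟨v, hv, hvi, hvj⟩ := exists_injective_map_pair hbN
      (p := 0) (q := 1) (by simp [Fin.ext_iff]; omega) hij
    have e1 := mul_arc_sub_terminal_eq h t γ hb v hv
    have e3 := mul_arc_sub_terminal_eq h t γ ha (v ∘ ε) (hv.comp hε)
    have hy : (a : ℝ) * (h ((v ∘ ε) 0) ((v ∘ ε) 1) - t ((v ∘ ε) 0)) = a * (h i j - t i) := by
      rcases Nat.eq_zero_or_pos a with rfl | hapos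
      · simp
      · simp only [comp_apply, hε0, hε1 hapos, hvi, hvj]
    rw [hy] at e3
    rw [hvi, hvj] at e1
    simp only [fun x => tconst x i, Finset.sum_const, Finset.card_univ, Fintype.card_fin,
      nsmul_eq_mul] at e1 e3
    push_cast at e1 e3
    have hba : (b : ℝ) - a ≠ 0 := sub_ne_zero.2 (by exact_mod_cast hab.ne')
    have hz : h i j = 0 := by
      refine (mul_eq_zero.1 ?_).resolve_left hba
      linarith
    rw [hz] at e1
    exact ⟨hz, by linarith⟩
  refine ⟨fun i j hij => (arc i j hij).1, fun i => ?_⟩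
  have : Nontrivial (Fin N) := Fin.nontrivial_iff_two_le.2 (by omega)
  obtain ⟨j, hj⟩ := exists_ne i
  exact (arc i j hj.symm).2

lemma card_tA (N : ℕ) : (tA (N + 1)).card = (N + 1) * N := by
  have h0 (i : Fin N) : i.castSucc.succ ≠ Fin.last (N + 1) := by
    rw [← Fin.succ_last]; simp [Fin.ext_iff, i.isLt.ne]
  have hrow (i : Fin N) : ∑ j : Fin N, (if i = j then 0 else 1) + 1 = N := by
    simp_rw [← ite_not (i = _) 1 0]
    rw [← Finset.card_filter, Finset.filter_ne, Finset.card_erase_add_one (Finset.mem_univ i)]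
    simp
  rw [tA, Finset.card_filter, Fintype.sum_prod_type]
  simp only [Fin.sum_univ_succ (n := N + 1), Fin.sum_univ_castSucc (n := N)]
  simp [h0, (h0 _).symm, Fin.succ_ne_zero, (Fin.succ_ne_zero _).symm]
  simp [hrow]
  ring

/-- The pairing of arc weights with arc vectors. -/
noncomputable def arcPairing (M : ℕ) :
    (Fin M → Fin M → ℝ) →ₗ[ℝ] Module.Dual ℝ (Fin M → Fin M → ℝ) :=
  LinearMap.mk₂ ℝ (fun g x => ∑ i, ∑ j, g i j * x i j)
    (fun g g' x => by simp [add_mul, Finset.sum_add_distrib])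
    (fun r g x => by simp [mul_assoc, Finset.mul_sum])
    (fun g x x' => by simp [mul_add, Finset.sum_add_distrib])
    (fun r g x => by simp [mul_left_comm, Finset.mul_sum])

lemma arcPairing_apply {M : ℕ} (g x : Fin M → Fin M → ℝ) :
    arcPairing M g x = ∑ i, ∑ j, g i j * x i j := rfl

lemma arcPairing_injective (M : ℕ) : Injective (arcPairing M) := by
  intro g g' hg
  ext i j
  have := LinearMap.congr_fun hg (Pi.single i (Pi.single j 1))
  simpa [arcPairing_apply, Pi.single_apply, ite_apply, Finset.sum_ite_eq] using this

lemma arcPairing_surjective (M : ℕ) : Surjective (arcPairing M) :=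
  (LinearMap.injective_iff_surjective_of_finrank_eq_finrank
    (Subspace.dual_finrank_eq).symm).1 (arcPairing_injective M)

lemma arcPairing_incVec {M : ℕ} (g : Fin M → Fin M → ℝ) (P : Finset (Fin M × Fin M)) :
    arcPairing M g (incVec P) = ∑ a ∈ P, g a.1 a.2 := by
  rw [arcPairing_apply, ← Fintype.sum_prod_type' (f := fun i j => g i j * incVec P i j)]
  simp [incVec, Finset.sum_ite_mem]

lemma injective_consecutive {α : Type*} {k : ℕ} {f : Fin (k + 1) → α} (hf : Injective f) :
    Injective fun i : Fin k => (f i.castSucc, f i.succ) := fun _ _ hij =>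
  Fin.castSucc_injective k (hf (Prod.ext_iff.1 hij).1)

/-- The node sequence of the path visiting the inner nodes `w`. -/
def throughNodes {N k : ℕ} (w : Fin (k + 1) → Fin N) : Fin (k + 3) → Fin (N + 2) :=
  Fin.cons 0 (Fin.snoc (α := fun _ => Fin (N + 2)) (fun i => (w i).castSucc.succ) (Fin.last (N + 1)))

/-- The arc set of the path visiting the inner nodes `w`. -/
def throughPath {N k : ℕ} (w : Fin (k + 1) → Fin N) : Finset (Fin (N + 2) × Fin (N + 2)) :=
  Finset.univ.image fun i : Fin (k + 2) =>
    (throughNodes w i.castSucc, throughNodes w i.succ)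

lemma throughNodes_inner {N k : ℕ} (w : Fin (k + 1) → Fin N) (i : Fin (k + 1)) :
    throughNodes w i.castSucc.succ = (w i).castSucc.succ := by
  rw [throughNodes, Fin.cons_succ, Fin.snoc_castSucc]

lemma throughNodes_last {N k : ℕ} (w : Fin (k + 1) → Fin N) :
    throughNodes w (Fin.last (k + 2)) = Fin.last (N + 1) := by
  rw [← Fin.succ_last, throughNodes, Fin.cons_succ, Fin.snoc_last]

lemma throughNodes_injective {N k : ℕ} {w : Fin (k + 1) → Fin N} (hw : Injective w) :
    Injective (throughNodes w) := by
  refine Fin.cons_injective_iff.2 ⟨?_, Fin.snoc_injective_iff.2 ⟨?_, ?_⟩⟩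
  · rintro ⟨i, hi⟩
    induction i using Fin.lastCases <;> simp [Fin.ext_iff] at hi
  · exact (Fin.succ_injective _).comp ((Fin.castSucc_injective _).comp hw)
  · rintro ⟨i, hi⟩
    have := (w i).isLt
    simp [Fin.ext_iff] at hi
    omega

lemma card_throughPath {N k : ℕ} {w : Fin (k + 1) → Fin N} (hw : Injective w) :
    (throughPath w).card = k + 2 := by
  rw [throughPath, Finset.card_image_of_injective _
    (injective_consecutive (throughNodes_injective hw))]
  simp

lemma sum_throughPath {N k : ℕ} {w : Fin (k + 1) → Fin N} (hw : Injective w)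
    (g : Fin (N + 2) → Fin (N + 2) → ℝ) :
    ∑ a ∈ throughPath w, g a.1 a.2 = g 0 (w 0).castSucc.succ +
      ∑ i : Fin k, g (w i.castSucc).castSucc.succ (w i.succ).castSucc.succ +
      g (w (Fin.last k)).castSucc.succ (Fin.last (N + 1)) := by
  rw [throughPath, Finset.sum_image
    (injective_consecutive (throughNodes_injective hw)).injOn, Fin.sum_univ_succ,
    Fin.sum_univ_castSucc]
  have h0 : throughNodes w (Fin.castSucc 0) = 0 := rfl
  have h1 (i : Fin k) : throughNodes w i.castSucc.succ.succ = (w i.succ).castSucc.succ :=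
    throughNodes_inner w i.succ
  have h2 : throughNodes w (Fin.succ 0) = (w 0).castSucc.succ := throughNodes_inner w 0
  have h4 : throughNodes w (Fin.last k).succ.succ = Fin.last (N + 1) := throughNodes_last w
  simp only [h0, h1, h2, h4, ← Fin.succ_castSucc, throughNodes_inner]
  ring

lemma isTildePath_throughPath {N k : ℕ} {w : Fin (k + 1) → Fin N} (hw : Injective w) :
    IsTildePath (N + 1) (throughPath w) := by
  have hinj := throughNodes_injective hw
  have h0 : throughNodes w 0 = 0 := rfl
  have hl := throughNodes_last w
  refine ⟨fun a ha => ?_, k + 2, throughNodes w, hinj, h0, hl, rfl⟩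
  obtain ⟨i, -, rfl⟩ := Finset.mem_image.1 ha
  rw [tA, Finset.mem_filter]
  refine ⟨Finset.mem_univ _, fun h => ?_, fun h => ?_, fun h => ?_, fun ⟨h, h'⟩ => ?_⟩
  · exact (Fin.castSucc_lt_succ (i := i)).ne (hinj h)
  · exact Fin.succ_ne_zero i (hinj (Eq.trans h h0.symm))
  · have e : i.castSucc = Fin.last (k + 2) := hinj (Eq.trans h hl.symm)
    exact (Fin.castSucc_lt_last i).ne e
  · have e : i.castSucc = 0 := hinj h
    have e' : i.succ = Fin.last (k + 2) := hinj (Eq.trans h' hl.symm)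
    have v : (i : ℕ) = 0 := congrArg Fin.val e
    have v' : (i : ℕ) + 1 = k + 2 := congrArg Fin.val e'
    omega

lemma IsTildePath.sum_potential {N : ℕ} {P : Finset (Fin (N + 2) × Fin (N + 2))}
    (hP : IsTildePath (N + 1) P) (u : Fin (N + 2) → ℝ) :
    ∑ a ∈ P, (u a.2 - u a.1) = u (Fin.last (N + 1)) - u 0 := by
  obtain ⟨-, k, f, hf, h0, hl, rfl⟩ := hP
  rw [Finset.sum_image (injective_consecutive hf).injOn, Finset.sum_sub_distrib, ← h0, ← hl]
  have h1 := Fin.sum_univ_succ fun i => u (f i)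
  have h2 := Fin.sum_univ_castSucc fun i => u (f i)
  simp only
  linarith

/-- An arc weight that is constant on all paths of two different cardinalities is the difference
of a node potential. -/
lemma exists_potential {N a b : ℕ} (hab : a < b) (hbN : b + 1 ≤ N)
    (g : Fin (N + 2) → Fin (N + 2) → ℝ) (γ : ℝ)
    (hg : ∀ P, IsTildePath (N + 1) P → P.card = a + 2 ∨ P.card = b + 2 →
      ∑ e ∈ P, g e.1 e.2 = γ) :
    ∃ u : Fin (N + 1) → ℝ, ∀ e ∈ tA (N + 1),
      g e.1 e.2 = (Fin.cons 0 u : Fin (N + 2) → ℝ) e.2 - (Fin.cons 0 u : Fin (N + 2) → ℝ) e.1 := by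
  let π (i : Fin N) : ℝ := g 0 i.castSucc.succ
  let h (i j : Fin N) : ℝ := g i.castSucc.succ j.castSucc.succ - (π j - π i)
  let t (i : Fin N) : ℝ := g i.castSucc.succ (Fin.last (N + 1)) + π i
  have hcost {k : ℕ} (hk : k = a ∨ k = b) (w : Fin (k + 1) → Fin N) (hw : Injective w) :
      ∑ i : Fin k, h (w i.castSucc) (w i.succ) + t (w (Fin.last k)) = γ := by
    have h1 := hg _ (isTildePath_throughPath hw) (by rw [card_throughPath hw]; omega)
    rw [sum_throughPath hw] at h1
    have h2 := Fin.sum_univ_succ fun i => π (w i)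
    have h3 := Fin.sum_univ_castSucc fun i => π (w i)
    simp only [h, t, Finset.sum_sub_distrib]
    simp only [π] at *
    linarith
  obtain ⟨hh, ht⟩ := arc_cost_eq_zero hab hbN h t γ (hcost (.inl rfl)) (hcost (.inr rfl))
  refine ⟨Fin.snoc (α := fun _ => ℝ) π γ, ?_⟩
  rintro ⟨i, j⟩ he
  simp only [tA, Finset.mem_filter, Finset.mem_univ, true_and] at he
  obtain ⟨hij, hj, hi, hij'⟩ := he
  simp only
  induction j using Fin.cases with
  | zero => exact absurd rfl hj
  | succ j =>
  induction i using Fin.cases with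
  | zero =>
    induction j using Fin.lastCases with
    | last => exact absurd ⟨rfl, Fin.succ_last _⟩ hij'
    | cast j => simp [π]
  | succ i =>
    induction i using Fin.lastCases with
    | last => exact absurd (Fin.succ_last _) hi
    | cast i =>
    induction j using Fin.lastCases with
    | last =>
      have := ht i
      simp only [t] at this
      simp only [Fin.succ_last, Fin.cons_succ, Fin.snoc_castSucc]
      rw [← Fin.succ_last, Fin.cons_succ, Fin.snoc_last, Fin.succ_last]
      linarith
    | cast j =>
      have := hh i j (fun h => hij (by rw [h]))
      simp only [h] at this
      simp only [Fin.cons_succ, Fin.snoc_castSucc]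
      linarith

/-- The weight given by a node potential, vanishing at `0`, on the arcs and arbitrary elsewhere. -/
noncomputable def potentialWeight (N : ℕ) :
    ({e // e ∉ tA (N + 1)} → ℝ) × (Fin (N + 1) → ℝ) →ₗ[ℝ] Fin (N + 2) → Fin (N + 2) → ℝ where
  toFun p i j := if he : (i, j) ∈ tA (N + 1) then
    (Fin.cons 0 p.2 : Fin (N + 2) → ℝ) j - (Fin.cons 0 p.2 : Fin (N + 2) → ℝ) i else p.1 ⟨(i, j), he⟩
  map_add' p q := by
    ext i j
    have hc (i : Fin (N + 2)) : (Fin.cons 0 (p.2 + q.2) : Fin (N + 2) → ℝ) i =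
        (Fin.cons 0 p.2 : Fin (N + 2) → ℝ) i + (Fin.cons 0 q.2 : Fin (N + 2) → ℝ) i := by
      induction i using Fin.cases <;> simp
    simp only [Pi.add_apply, Prod.fst_add, Prod.snd_add, hc]
    split_ifs <;> ring
  map_smul' r p := by
    ext i j
    have hc (i : Fin (N + 2)) : (Fin.cons 0 (r • p.2) : Fin (N + 2) → ℝ) i =
        r * (Fin.cons 0 p.2 : Fin (N + 2) → ℝ) i := by
      induction i using Fin.cases <;> simp
    simp only [Pi.smul_apply, Prod.smul_fst, Prod.smul_snd, hc, smul_eq_mul, RingHom.id_apply]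
    split_ifs <;> ring

lemma potentialWeight_of_mem {N : ℕ} (p : ({e // e ∉ tA (N + 1)} → ℝ) × (Fin (N + 1) → ℝ))
    {i j : Fin (N + 2)} (he : (i, j) ∈ tA (N + 1)) :
    potentialWeight N p i j =
      (Fin.cons 0 p.2 : Fin (N + 2) → ℝ) j - (Fin.cons 0 p.2 : Fin (N + 2) → ℝ) i :=
  dif_pos he

lemma potentialWeight_of_notMem {N : ℕ} (p : ({e // e ∉ tA (N + 1)} → ℝ) × (Fin (N + 1) → ℝ))
    {i j : Fin (N + 2)} (he : (i, j) ∉ tA (N + 1)) :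
    potentialWeight N p i j = p.1 ⟨(i, j), he⟩ :=
  dif_neg he

lemma potentialWeight_injective {N : ℕ} (hN : 0 < N) : Injective (potentialWeight N) := by
  rw [← LinearMap.ker_eq_bot, LinearMap.ker_eq_bot']
  intro p hp
  have hw (i j) : potentialWeight N p i j = 0 := by rw [hp]; rfl
  have inner (i : Fin N) : p.2 i.castSucc = 0 := by
    have hm : ((0, i.castSucc.succ) : Fin (N + 2) × Fin (N + 2)) ∈ tA (N + 1) := by
      have := i.isLt
      simp only [tA, Finset.mem_filter, Finset.mem_univ, true_and, ne_eq, Fin.ext_iff]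
      simp
      omega
    simpa [potentialWeight_of_mem p hm] using hw 0 i.castSucc.succ
  have last : p.2 (Fin.last N) = 0 := by
    let i : Fin N := ⟨0, hN⟩
    have hm : ((i.castSucc.succ, (Fin.last N).succ) : Fin (N + 2) × Fin (N + 2)) ∈ tA (N + 1) := by
      have := i.isLt
      simp only [tA, Finset.mem_filter, Finset.mem_univ, true_and, ne_eq, Fin.ext_iff]
      simp
      omega
    have := hw i.castSucc.succ (Fin.last N).succ
    rw [potentialWeight_of_mem p hm, Fin.cons_succ, Fin.cons_succ, inner i] at this
    linarith
  refine Prod.ext (funext fun e => ?_) (funext fun i => ?_)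
  · exact (potentialWeight_of_notMem p e.2).symm.trans (hw e.1.1 e.1.2)
  · induction i using Fin.lastCases with
    | last => exact last
    | cast i => exact inner i

/-- The linear functionals vanishing on the direction of a path polytope with at least two
cardinalities are the pairings with potential weights. -/
lemma dualAnnihilator_vectorSpan_pathPolytope {N m : ℕ} (c : Fin m → ℕ) {p q : Fin m} {a b : ℕ}
    (hab : a < b) (hbN : b + 1 ≤ N) (hp : c p = a + 2) (hq : c q = b + 2) :
    (vectorSpan ℝ (pathPolytope (N + 1) c)).dualAnnihilator =
      LinearMap.range (arcPairing (N + 2) ∘ₗ potentialWeight N) := by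
  rw [pathPolytope, ← direction_affineSpan, affineSpan_convexHull, direction_affineSpan]
  ext φ
  obtain ⟨g, rfl⟩ := arcPairing_surjective _ φ
  rw [Submodule.mem_dualAnnihilator]
  constructor
  · intro h
    have hw : Injective (Fin.castLE hbN) := Fin.castLE_injective hbN
    have hg (P) (hP : IsTildePath (N + 1) P) (hc : P.card = a + 2 ∨ P.card = b + 2) :
        ∑ e ∈ P, g e.1 e.2 = ∑ e ∈ throughPath (Fin.castLE hbN), g e.1 e.2 := by
      have hc' : ∃ p, P.card = c p := hc.elim (fun h => ⟨p, h.trans hp.symm⟩)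
        fun h => ⟨q, h.trans hq.symm⟩
      have := h _ (vsub_mem_vectorSpan ℝ (s := {x | ∃ P, IsTildePath (N + 1) P ∧
        (∃ p, P.card = c p) ∧ x = incVec P}) ⟨P, hP, hc', rfl⟩
        ⟨_, isTildePath_throughPath hw, ⟨q, (card_throughPath hw).trans hq.symm⟩, rfl⟩)
      rwa [vsub_eq_sub, map_sub, arcPairing_incVec, arcPairing_incVec, sub_eq_zero] at this
    obtain ⟨u, hu⟩ := exists_potential hab hbN g _ hg
    refine ⟨(fun e => g e.1.1 e.1.2, u), congrArg (arcPairing (N + 2)) ?_⟩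
    ext i j
    by_cases he : (i, j) ∈ tA (N + 1)
    · rw [potentialWeight_of_mem _ he, hu _ he]
    · rw [potentialWeight_of_notMem _ he]
  · rintro ⟨r, hr⟩ x hx
    rw [← hr]
    suffices h : vectorSpan ℝ {x | ∃ P, IsTildePath (N + 1) P ∧ (∃ p, P.card = c p) ∧
        x = incVec P} ≤ LinearMap.ker (arcPairing (N + 2) (potentialWeight N r)) from h hx
    refine Submodule.span_le.2 ?_
    rintro _ ⟨_, ⟨P, hP, -, rfl⟩, _, ⟨Q, hQ, -, rfl⟩, rfl⟩
    have key {P} (hP : IsTildePath (N + 1) P) :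
        ∑ e ∈ P, potentialWeight N r e.1 e.2 =
          (Fin.cons 0 r.2 : Fin (N + 2) → ℝ) (Fin.last (N + 1)) -
            (Fin.cons 0 r.2 : Fin (N + 2) → ℝ) 0 := by
      rw [← hP.sum_potential]
      exact Finset.sum_congr rfl fun e he => potentialWeight_of_mem r (hP.1 he)
    simp only [SetLike.mem_coe, LinearMap.mem_ker, vsub_eq_sub, map_sub, arcPairing_incVec]
    rw [key hP, key hQ, sub_self]

/-- **Dimension of the cardinality constrained path polytope.**  For `n ≥ 3` and a
cardinality sequence `c` with `m ≥ 2` and `2 ≤ c 0 < ⋯ < c (m-1) ≤ n`, the polytope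
`P_{0,n-path}^c(D̃_n)` has dimension `n² − 2n`. -/
theorem dim_pathPolytope (n m : ℕ) (hn : 3 ≤ n) (hm : 2 ≤ m)
    (c : Fin m → ℕ) (hmono : StrictMono c)
    (hc2 : ∀ p, 2 ≤ c p) (hcn : ∀ p, c p ≤ n) :
    adim (pathPolytope n c) = n ^ 2 - 2 * n := by
  obtain ⟨N, rfl⟩ : ∃ N, n = N + 1 := ⟨n - 1, by omega⟩
  have hlt : c ⟨0, by omega⟩ < c ⟨1, by omega⟩ := hmono (by simp [Fin.lt_def])
  have h0 := hc2 ⟨0, by omega⟩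
  have h1 := hcn ⟨1, by omega⟩
  have hann := dualAnnihilator_vectorSpan_pathPolytope (N := N) c (a := c ⟨0, by omega⟩ - 2)
    (b := c ⟨1, by omega⟩ - 2) (p := ⟨0, by omega⟩) (q := ⟨1, by omega⟩)
    (by omega) (by omega) (by omega) (by omega)
  have hdim := Subspace.finrank_add_finrank_dualAnnihilator_eq
    (vectorSpan ℝ (pathPolytope (N + 1) c))
  have hinj : Injective (arcPairing (N + 2) ∘ₗ potentialWeight N) :=
    (arcPairing_injective _).comp (potentialWeight_injective (by omega))
  rw [hann, LinearMap.finrank_range_of_inj hinj, Module.finrank_prod,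
    Module.finrank_fintype_fun_eq_card, Module.finrank_fintype_fun_eq_card, Fintype.card_subtype_compl,
    Module.finrank_pi_fintype] at hdim
  simp only [Module.finrank_fintype_fun_eq_card, Fintype.card_prod, Fintype.card_fin,
    Fintype.card_coe, card_tA, Finset.sum_const, Finset.card_univ, smul_eq_mul] at hdim
  rw [adim]
  have h2 : (N + 2) * (N + 2) - (N + 1) * N = 3 * N + 4 := by
    rw [Nat.sub_eq_iff_eq_add (by nlinarith)]; ring
  have h3 : (N + 1) ^ 2 - 2 * (N + 1) + 1 = N * N := by
    have : 2 * (N + 1) ≤ (N + 1) ^ 2 := by nlinarith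
    zify [this]; ring
  rw [h2] at hdim
  nlinarith
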